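/- Consider the sequences produced by Algorithm AGM-EF-∞ (as specified in the context, with each minimizer z_{k+1} of ψ_{k+1} over E assumed to exist). Then for every k ≥ 1 and every x ∈ dom Ψ, J(x_k) − J(x) ≤ Δ(x, x₀) · min{ 4L/(σ(k+1)²), ((L − σλ1)/σ) (1 + √(σλ/(4L)))^{−2k+2} }. -/

import Mathlib

noncomputable section

open scoped BigOperators

/-- Bregman divergence induced by `d`. -/
def breg {E : Type*} [NormedAddCommGroup E] [NormedSpace ℝ E]
    (d : E → ℝ) (x y : E) : ℝ :=
  d x - d y - fderiv ℝ d y (x - y)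

/-- `d` is `σ`-strongly convex with respect to the norm `‖·‖`. -/
def StrongConvexOnNorm {E : Type*} [NormedAddCommGroup E] [NormedSpace ℝ E]
    (σ : ℝ) (d : E → ℝ) : Prop :=
  ∀ x y : E, d x ≥ d y + fderiv ℝ d y (x - y) + σ / 2 * ‖x - y‖ ^ 2

/-- `g` is a subgradient of the extended-real-valued function `h` at `y`. -/
def IsSubgradE {E : Type*} [NormedAddCommGroup E] [NormedSpace ℝ E]
    (h : E → EReal) (y : E) (g : E →L[ℝ] ℝ) : Prop :=
  ∀ x, h x ≥ h y + ((g (x - y) : ℝ) : EReal)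

/-- `h` is `lam`-strongly convex with respect to `d` (extended-real-valued version). -/
def ScWrtE {E : Type*} [NormedAddCommGroup E] [NormedSpace ℝ E]
    (d : E → ℝ) (lam : ℝ) (h : E → EReal) : Prop :=
  ∀ y : E, h y ≠ ⊤ → ∀ g : E →L[ℝ] ℝ, IsSubgradE h y g →
    ∀ x, h x ≥ h y + ((g (x - y) + lam * breg d x y : ℝ) : EReal)

/-- `f` is `lam`-strongly convex with respect to `d` (real-valued version). -/
def ScWrtR {E : Type*} [NormedAddCommGroup E] [NormedSpace ℝ E]
    (d : E → ℝ) (lam : ℝ) (f : E → ℝ) : Prop :=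
  ∀ y : E, ∀ g : E →L[ℝ] ℝ, (∀ x, f x ≥ f y + g (x - y)) →
    ∀ x, f x ≥ f y + g (x - y) + lam * breg d x y

/-- Convexity for extended-real-valued functions. -/
def ConvexE {E : Type*} [NormedAddCommGroup E] [NormedSpace ℝ E]
    (h : E → EReal) : Prop :=
  ∀ x y : E, ∀ a b : ℝ, 0 ≤ a → 0 ≤ b → a + b = 1 →
    h (a • x + b • y) ≤ ((a : ℝ) : EReal) * h x + ((b : ℝ) : EReal) * h y

/-- The lower model `ℓ_f(x; y, lam1)`. -/
def ellf {E : Type*} [NormedAddCommGroup E] [NormedSpace ℝ E]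
    (d : E → ℝ) (f : E → ℝ) (lam1 : ℝ) (x y : E) : ℝ :=
  f y + fderiv ℝ f y (x - y) + lam1 * breg d x y


lemma subgrad_of_eventually_min {E : Type*} [NormedAddCommGroup E] [NormedSpace ℝ E]
    {D : Set E} {P s : E → ℝ} {s' : E →L[ℝ] ℝ} {y : E} {c : ℝ} (hP : ConvexOn ℝ D P)
    (hy : y ∈ D) (hc : 0 ≤ c) (hs : HasFDerivAt s s' y)
    (hmin : ∀ᶠ w in nhds y, w ∈ D → c * P y + s y ≤ c * P w + s w) {w : E} (hw : w ∈ D) :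
    c * P y - s' (w - y) ≤ c * P w := by
  have hγ : HasDerivAt (fun t : ℝ => y + t • (w - y)) (w - y) 0 := by
    simpa using ((hasDerivAt_id (0 : ℝ)).smul_const (w - y)).const_add y
  have hγ0 : y + (0 : ℝ) • (w - y) = y := by simp
  have hs0 : HasFDerivAt s s' (y + (0 : ℝ) • (w - y)) := by rwa [hγ0]
  have hd : HasDerivAt (fun t : ℝ => t * (c * (P w - P y)) + s (y + t • (w - y)))
      (c * (P w - P y) + s' (w - y)) 0 := by
    have h := ((hasDerivAt_id (0 : ℝ)).mul_const (c * (P w - P y))).add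
      (hs0.comp_hasDerivAt (0 : ℝ) hγ)
    rw [one_mul] at h
    exact h
  have hlim := hd.tendsto_slope_zero_right
  have hcont : Filter.Tendsto (fun t : ℝ => y + t • (w - y)) (nhdsWithin 0 (Set.Ioi 0))
      (nhds y) := by
    have := hγ.continuousAt.tendsto
    rw [hγ0] at this
    exact this.mono_left nhdsWithin_le_nhds
  have hnonneg : 0 ≤ c * (P w - P y) + s' (w - y) := by
    refine ge_of_tendsto hlim ?_
    filter_upwards [hcont.eventually hmin, Ioo_mem_nhdsGT (zero_lt_one' ℝ)] with t ht ht01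
    have hmem : y + t • (w - y) = (1 - t) • y + t • w := by module
    have hD : y + t • (w - y) ∈ D := by
      rw [hmem]; exact hP.1 hy hw (by linarith [ht01.2]) ht01.1.le (by ring)
    have hconv : P (y + t • (w - y)) ≤ (1 - t) * P y + t * P w := by
      rw [hmem]; exact hP.2 hy hw (by linarith [ht01.2]) ht01.1.le (by ring)
    have h1 := ht hD
    have h2 := mul_le_mul_of_nonneg_left hconv hc
    simp only [zero_add, zero_smul, add_zero, zero_mul, smul_eq_mul]
    refine mul_nonneg (inv_nonneg.2 ht01.1.le) ?_
    linarith
  linarith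

lemma le_quadratic_of_lipschitz_fderiv {E : Type*} [NormedAddCommGroup E] [NormedSpace ℝ E]
    {f : E → ℝ} {L : ℝ} (hf : Differentiable ℝ f)
    (hL : ∀ x y : E, ‖fderiv ℝ f x - fderiv ℝ f y‖ ≤ L * ‖x - y‖) (x u : E) :
    f x ≤ f u + fderiv ℝ f u (x - u) + L / 2 * ‖x - u‖ ^ 2 := by
  have hγ : ∀ t : ℝ, HasDerivAt (fun t : ℝ => u + t • (x - u)) (x - u) t := fun t => by
    simpa using ((hasDerivAt_id t).smul_const (x - u)).const_add u
  have hd : ∀ t : ℝ, HasDerivAt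
      (fun t : ℝ => f (u + t • (x - u)) - t * fderiv ℝ f u (x - u)
        - t ^ 2 * (L / 2 * ‖x - u‖ ^ 2))
      (fderiv ℝ f (u + t • (x - u)) (x - u) - fderiv ℝ f u (x - u)
        - 2 * t * (L / 2 * ‖x - u‖ ^ 2)) t := fun t => by
    have h1 := (hf (u + t • (x - u))).hasFDerivAt.comp_hasDerivAt t (hγ t)
    have h2 := (hasDerivAt_id t).mul_const (fderiv ℝ f u (x - u))
    have h3 := ((hasDerivAt_id t).pow 2).mul_const (L / 2 * ‖x - u‖ ^ 2)
    have h := (h1.sub h2).sub h3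
    refine h.congr_deriv ?_
    simp
  have hanti : AntitoneOn (fun t : ℝ => f (u + t • (x - u)) - t * fderiv ℝ f u (x - u)
        - t ^ 2 * (L / 2 * ‖x - u‖ ^ 2)) (Set.Ici 0) := by
    refine antitoneOn_of_deriv_nonpos (convex_Ici 0)
      (fun t _ => (hd t).continuousAt.continuousWithinAt)
      (fun t _ => (hd t).differentiableAt.differentiableWithinAt) fun t ht => ?_
    rw [interior_Ici, Set.mem_Ioi] at ht
    rw [(hd t).deriv]
    have h1 : fderiv ℝ f (u + t • (x - u)) (x - u) - fderiv ℝ f u (x - u)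
        ≤ L * ‖t • (x - u)‖ * ‖x - u‖ := by
      have h := hL (u + t • (x - u)) u
      rw [add_sub_cancel_left] at h
      calc _ = (fderiv ℝ f (u + t • (x - u)) - fderiv ℝ f u) (x - u) := rfl
        _ ≤ ‖(fderiv ℝ f (u + t • (x - u)) - fderiv ℝ f u) (x - u)‖ := le_abs_self _
        _ ≤ ‖fderiv ℝ f (u + t • (x - u)) - fderiv ℝ f u‖ * ‖x - u‖ :=
          ContinuousLinearMap.le_opNorm _ _
        _ ≤ _ := by gcongr
    rw [norm_smul, Real.norm_of_nonneg ht.le] at h1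
    linarith
  have h := hanti (Set.mem_Ici.2 le_rfl) (Set.mem_Ici.2 zero_le_one) zero_le_one
  simp only [one_smul, zero_smul, add_zero, add_sub_cancel] at h
  linarith

lemma sq_norm_add_add_le {E : Type*} [NormedAddCommGroup E] [NormedSpace ℝ E]
    {s t r : ℝ} (hs : 0 ≤ s) (ht : 0 ≤ t) (hr : 0 ≤ r) (p q v : E) :
    ‖s • p + t • q + r • v‖ ^ 2
      ≤ (s + t + r) * (s * ‖p‖ ^ 2 + t * ‖q‖ ^ 2 + r * ‖v‖ ^ 2) := by
  have h : ‖s • p + t • q + r • v‖ ≤ s * ‖p‖ + t * ‖q‖ + r * ‖v‖ := by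
    refine (norm_add₃_le).trans_eq ?_
    rw [norm_smul, norm_smul, norm_smul, Real.norm_of_nonneg hs, Real.norm_of_nonneg ht,
      Real.norm_of_nonneg hr]
  calc _ ≤ (s * ‖p‖ + t * ‖q‖ + r * ‖v‖) ^ 2 := by gcongr
    _ ≤ _ := by
      have h1 := mul_nonneg (mul_nonneg hs ht) (sq_nonneg (‖p‖ - ‖q‖))
      have h2 := mul_nonneg (mul_nonneg hs hr) (sq_nonneg (‖p‖ - ‖v‖))
      have h3 := mul_nonneg (mul_nonneg ht hr) (sq_nonneg (‖q‖ - ‖v‖))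
      linarith

lemma hasFDerivAt_breg {E : Type*} [NormedAddCommGroup E] [NormedSpace ℝ E]
    {d : E → ℝ} (hd : Differentiable ℝ d) (y w : E) :
    HasFDerivAt (fun x => breg d x y) (fderiv ℝ d w - fderiv ℝ d y) w := by
  have h := ((hd w).hasFDerivAt.sub_const (d y)).sub
    ((fderiv ℝ d y).hasFDerivAt.comp w ((hasFDerivAt_id w).sub_const y))
  rw [ContinuousLinearMap.comp_id] at h
  exact h

lemma StrongConvexOnNorm.le_breg {E : Type*} [NormedAddCommGroup E] [NormedSpace ℝ E]
    {d : E → ℝ} {σ : ℝ} (hd : StrongConvexOnNorm σ d) (x y : E) :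
    σ / 2 * ‖x - y‖ ^ 2 ≤ breg d x y := by
  have := hd x y
  unfold breg
  linarith

lemma ConvexE.convexOn_toReal {E : Type*} [NormedAddCommGroup E] [NormedSpace ℝ E]
    {Ψ : E → EReal} (hbot : ∀ x, Ψ x ≠ ⊥) (hΨ : ConvexE Ψ) :
    ConvexOn ℝ {w | Ψ w ≠ ⊤} (fun w => (Ψ w).toReal) := by
  have key : ∀ x, Ψ x ≠ ⊤ → ∀ y, Ψ y ≠ ⊤ → ∀ a b : ℝ, 0 ≤ a → 0 ≤ b → a + b = 1 →
      Ψ (a • x + b • y) ≤ ((a * (Ψ x).toReal + b * (Ψ y).toReal : ℝ) : EReal) := by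
    intro x hx y hy a b ha hb hab
    have h := hΨ x y a b ha hb hab
    rw [← EReal.coe_toReal hx (hbot x), ← EReal.coe_toReal hy (hbot y)] at h
    exact_mod_cast h
  refine ⟨fun x hx y hy a b ha hb hab => ne_top_of_le_ne_top (EReal.coe_ne_top _)
    (key x hx y hy a b ha hb hab), fun x hx y hy a b ha hb hab => ?_⟩
  have h := key x hx y hy a b ha hb hab
  rw [← EReal.coe_toReal (ne_top_of_le_ne_top (EReal.coe_ne_top _) h) (hbot _)] at h
  exact_mod_cast h

lemma ScWrtE.toReal_le {E : Type*} [NormedAddCommGroup E] [NormedSpace ℝ E]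
    {d : E → ℝ} {lam : ℝ} {Ψ : E → EReal} (hbot : ∀ x, Ψ x ≠ ⊥) (hΨ : ScWrtE d lam Ψ)
    {y : E} (hy : Ψ y ≠ ⊤) {g : E →L[ℝ] ℝ}
    (hg : ∀ w, Ψ w ≠ ⊤ → (Ψ y).toReal + g (w - y) ≤ (Ψ w).toReal) {w : E} (hw : Ψ w ≠ ⊤) :
    (Ψ y).toReal + g (w - y) + lam * breg d w y ≤ (Ψ w).toReal := by
  have hsub : IsSubgradE Ψ y g := by
    intro v
    by_cases hv : Ψ v = ⊤
    · rw [hv]; exact le_top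
    · rw [← EReal.coe_toReal hv (hbot v), ← EReal.coe_toReal hy (hbot y)]
      exact_mod_cast hg v hv
  have h := hΨ y hy g hsub w
  rw [← EReal.coe_toReal hw (hbot w), ← EReal.coe_toReal hy (hbot y)] at h
  have h' : (Ψ y).toReal + (g (w - y) + lam * breg d w y) ≤ (Ψ w).toReal := by exact_mod_cast h
  linarith

/-- First order optimality for a strongly convex function plus a differentiable one. -/
lemma ScWrtE.le_of_eventually_min {E : Type*} [NormedAddCommGroup E] [NormedSpace ℝ E]
    {d : E → ℝ} {lam : ℝ} {Ψ : E → EReal} (hbot : ∀ x, Ψ x ≠ ⊥) (hconv : ConvexE Ψ)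
    (hΨ : ScWrtE d lam Ψ) {s : E → ℝ} {s' : E →L[ℝ] ℝ} {y : E} {c : ℝ} (hy : Ψ y ≠ ⊤)
    (hc : 0 < c) (hs : HasFDerivAt s s' y)
    (hmin : ∀ᶠ w in nhds y, Ψ w ≠ ⊤ → c * (Ψ y).toReal + s y ≤ c * (Ψ w).toReal + s w)
    {w : E} (hw : Ψ w ≠ ⊤) :
    c * (Ψ y).toReal - s' (w - y) + c * (lam * breg d w y) ≤ c * (Ψ w).toReal := by
  have hg : ∀ w, Ψ w ≠ ⊤ → (Ψ y).toReal + (-(c⁻¹ • s')) (w - y) ≤ (Ψ w).toReal := by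
    intro w hw
    have h := subgrad_of_eventually_min (hconv.convexOn_toReal hbot) hy hc.le hs hmin hw
    have h2 := mul_le_mul_of_nonneg_left h (inv_nonneg.2 hc.le)
    simp only [neg_apply, smul_apply, smul_eq_mul]
    rw [mul_sub, inv_mul_cancel_left₀ hc.ne', inv_mul_cancel_left₀ hc.ne'] at h2
    linarith
  have h := mul_le_mul_of_nonneg_left (hΨ.toReal_le hbot hy hg hw) hc.le
  simp only [neg_apply, smul_apply, smul_eq_mul] at h
  have hcc : c * (c⁻¹ * s' (w - y)) = s' (w - y) := mul_inv_cancel_left₀ hc.ne' _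
  linarith

/-- Proximal points of `Ψ` around a point `p` of its domain are close to `p`. -/
lemma exists_prox {E : Type*} [NormedAddCommGroup E] [NormedSpace ℝ E] [FiniteDimensional ℝ E]
    {d : E → ℝ} {σ : ℝ} (hσ : 0 < σ) (hd : Differentiable ℝ d) (hdsc : StrongConvexOnNorm σ d)
    {Ψ : E → EReal} (hbot : ∀ x, Ψ x ≠ ⊥) (hlsc : LowerSemicontinuous Ψ) {p : E}
    (hp : Ψ p ≠ ⊤) {δ : ℝ} (hδ : 0 < δ) :
    ∃ n : ℝ, 0 < n ∧ ∃ y, Ψ y ≠ ⊤ ∧ ‖y - p‖ < δ ∧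
      ∀ᶠ w in nhds y, Ψ w ≠ ⊤ →
        1 * (Ψ y).toReal + n * breg d y p ≤ 1 * (Ψ w).toReal + n * breg d w p := by
  have hK : IsCompact (Metric.closedBall p δ) := isCompact_closedBall p δ
  have hpK : p ∈ Metric.closedBall p δ := Metric.mem_closedBall_self hδ.le
  obtain ⟨m, -, hm⟩ := (hlsc.lowerSemicontinuousOn _).exists_isMinOn ⟨p, hpK⟩ hK
  have hmp : Ψ m ≤ Ψ p := hm hpK
  have hmp' : (Ψ m).toReal ≤ (Ψ p).toReal := EReal.toReal_le_toReal hmp (hbot m) hp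
  set n : ℝ := ((Ψ p).toReal - (Ψ m).toReal + 1) / (σ / 2 * δ ^ 2) with hn
  have hden : 0 < σ / 2 * δ ^ 2 := by positivity
  have hn0 : 0 < n := div_pos (by linarith) hden
  have hcont : Continuous (fun w => n * breg d w p) :=
    continuous_const.mul (continuous_iff_continuousAt.2
      fun w => (hasFDerivAt_breg hd p w).continuousAt)
  have hlsc2 : LowerSemicontinuous (fun w => Ψ w + ((n * breg d w p : ℝ) : EReal)) :=
    hlsc.add' (continuous_coe_real_ereal.comp hcont).lowerSemicontinuous fun w =>
      EReal.continuousAt_add (Or.inr (EReal.coe_ne_bot _)) (Or.inr (EReal.coe_ne_top _))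
  obtain ⟨y, hyK, hy⟩ := (hlsc2.lowerSemicontinuousOn _).exists_isMinOn ⟨p, hpK⟩ hK
  have hyp : Ψ y + ((n * breg d y p : ℝ) : EReal) ≤ Ψ p + ((n * breg d p p : ℝ) : EReal) :=
    hy hpK
  have hyt : Ψ y ≠ ⊤ := by
    intro h
    rw [h, EReal.top_add_coe, ← EReal.coe_toReal hp (hbot p), ← EReal.coe_add] at hyp
    exact EReal.coe_ne_top _ (top_le_iff.1 hyp)
  have hmin : ∀ w ∈ Metric.closedBall p δ, Ψ w ≠ ⊤ →
      (Ψ y).toReal + n * breg d y p ≤ (Ψ w).toReal + n * breg d w p := by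
    intro w hwK hw
    have h : Ψ y + ((n * breg d y p : ℝ) : EReal) ≤ Ψ w + ((n * breg d w p : ℝ) : EReal) :=
      hy hwK
    rw [← EReal.coe_toReal hyt (hbot y), ← EReal.coe_toReal hw (hbot w)] at h
    exact_mod_cast h
  have hclose : ‖y - p‖ < δ := by
    by_contra! hge
    have h1 := hmin p hpK hp
    have h2 : (Ψ m).toReal ≤ (Ψ y).toReal := EReal.toReal_le_toReal (hm hyK) (hbot m) hyt
    have h3 : σ / 2 * δ ^ 2 ≤ breg d y p :=
      le_trans (by gcongr) (hdsc.le_breg y p)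
    have h4 : n * (σ / 2 * δ ^ 2) = (Ψ p).toReal - (Ψ m).toReal + 1 := by
      rw [hn]; exact div_mul_cancel₀ _ hden.ne'
    have h5 := mul_le_mul_of_nonneg_left h3 hn0.le
    have h6 : breg d p p = 0 := by simp [breg]
    rw [h6] at h1
    linarith
  refine ⟨n, hn0, y, hyt, hclose, ?_⟩
  filter_upwards [Metric.isOpen_ball.mem_nhds (by simpa [dist_eq_norm] using hclose :
    y ∈ Metric.ball p δ)] with w hwb hw
  rw [one_mul, one_mul]
  exact hmin w (Metric.ball_subset_closedBall hwb) hw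

/-- Strong convexity along segments, deduced from the subgradient definition. -/
lemma ScWrtE.toReal_convex_comb_le {E : Type*} [NormedAddCommGroup E] [NormedSpace ℝ E]
    [FiniteDimensional ℝ E] {d : E → ℝ} {σ lam : ℝ} (hσ : 0 < σ) (hlam : 0 ≤ lam)
    (hd : Differentiable ℝ d) (hdsc : StrongConvexOnNorm σ d)
    {Ψ : E → EReal} (hbot : ∀ x, Ψ x ≠ ⊥) (hlsc : LowerSemicontinuous Ψ)
    (hconv : ConvexE Ψ) (hΨ : ScWrtE d lam Ψ) {x y : E} (hx : Ψ x ≠ ⊤) (hy : Ψ y ≠ ⊤)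
    {α β : ℝ} (hα : 0 ≤ α) (hβ : 0 ≤ β) (hαβ : α + β = 1) :
    (Ψ (α • x + β • y)).toReal + lam * (σ / 2 * (α * β * ‖x - y‖ ^ 2))
      ≤ α * (Ψ x).toReal + β * (Ψ y).toReal := by
  set p := α • x + β • y with hp
  have hpt : Ψ p ≠ ⊤ := (hconv.convexOn_toReal hbot).1 hx hy hα hβ hαβ
  have hnorm : α * ‖x - p‖ ^ 2 + β * ‖y - p‖ ^ 2 = α * β * ‖x - y‖ ^ 2 := by
    have h1 : x - p = β • (x - y) := by
      rw [hp, show α = 1 - β by linarith]; module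
    have h2 : y - p = (-α) • (x - y) := by
      rw [hp, show β = 1 - α by linarith]; module
    rw [h1, h2, norm_smul, norm_smul, mul_pow, mul_pow, Real.norm_eq_abs, Real.norm_eq_abs,
      sq_abs, sq_abs]
    linear_combination (α * β * ‖x - y‖ ^ 2) * hαβ
  rw [← hnorm]
  refine le_of_forall_pos_sub_le fun ε hε => ?_
  have hQ : ContinuousAt (fun v => lam * (σ / 2 * (α * ‖x - v‖ ^ 2 + β * ‖y - v‖ ^ 2))) p := by
    fun_prop
  have hQ' := hQ.eventually (lt_mem_nhds (sub_lt_self _ (half_pos hε)))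
  have hΨ' := hlsc p (((Ψ p).toReal - ε / 2 : ℝ) : EReal) (by
    refine lt_of_lt_of_eq ?_ (EReal.coe_toReal hpt (hbot p))
    exact_mod_cast sub_lt_self _ (half_pos hε))
  obtain ⟨δ, hδ, hball⟩ := Metric.eventually_nhds_iff.1 (hQ'.and hΨ')
  obtain ⟨n, hn, v, hvt, hvp, hmin⟩ := exists_prox hσ hd hdsc hbot hlsc hpt hδ
  obtain ⟨hQv, hΨv⟩ := hball (by rwa [dist_eq_norm])
  change (((Ψ p).toReal - ε / 2 : ℝ) : EReal) < Ψ v at hΨv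
  rw [← EReal.coe_toReal hvt (hbot v), EReal.coe_lt_coe_iff] at hΨv
  have hopt := fun {w : E} (hw : Ψ w ≠ ⊤) =>
    hΨ.le_of_eventually_min hbot hconv hvt one_pos ((hasFDerivAt_breg hd p v).const_mul n) hmin hw
  have ox := mul_le_mul_of_nonneg_left (hopt hx) hα
  have oy := mul_le_mul_of_nonneg_left (hopt hy) hβ
  have bx := mul_le_mul_of_nonneg_left
    (mul_le_mul_of_nonneg_left (hdsc.le_breg x v) hlam) hα
  have bY := mul_le_mul_of_nonneg_left
    (mul_le_mul_of_nonneg_left (hdsc.le_breg y v) hlam) hβ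
  set G := n • (fderiv ℝ d v - fderiv ℝ d p) with hG
  have hGp : α * G (x - v) + β * G (y - v) = G (p - v) := by
    rw [← smul_eq_mul, ← smul_eq_mul, ← map_smul, ← map_smul, ← map_add]
    congr 1
    rw [hp]
    calc _ = α • x + β • y - (α + β) • v := by module
      _ = _ := by rw [hαβ, one_smul]
  have hGneg : G (p - v) ≤ 0 := by
    have h1 := (by positivity : (0 : ℝ) ≤ σ / 2 * ‖v - p‖ ^ 2).trans (hdsc.le_breg v p)
    have h2 := (by positivity : (0 : ℝ) ≤ σ / 2 * ‖p - v‖ ^ 2).trans (hdsc.le_breg p v)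
    have h3 : fderiv ℝ d p (v - p) = - fderiv ℝ d p (p - v) := by
      rw [← map_neg, neg_sub]
    unfold breg at h1 h2
    rw [h3] at h1
    simp only [hG, smul_apply, sub_apply, smul_eq_mul]
    exact mul_nonpos_of_nonneg_of_nonpos hn.le (by linarith)
  have hv1 : α * (Ψ v).toReal + β * (Ψ v).toReal = (Ψ v).toReal := by
    rw [← add_mul, hαβ, one_mul]
  linarith

lemma ConvexOn.add_fderiv_le {E : Type*} [NormedAddCommGroup E] [NormedSpace ℝ E]
    {f : E → ℝ} (hf : ConvexOn ℝ Set.univ f) (hd : Differentiable ℝ f) (x y : E) :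
    f y + fderiv ℝ f y (x - y) ≤ f x := by
  have hγ : HasDerivAt (AffineMap.lineMap (k := ℝ) y x) (x - y) 0 :=
    AffineMap.hasDerivAt_lineMap
  have hc : ConvexOn ℝ Set.univ (f ∘ AffineMap.lineMap (k := ℝ) y x) := by
    simpa using hf.comp_affineMap (AffineMap.lineMap (k := ℝ) y x)
  have hfd : HasFDerivAt f (fderiv ℝ f y) (AffineMap.lineMap y x (0 : ℝ)) := by
    simpa using (hd y).hasFDerivAt
  have h := hc.le_slope_of_hasDerivAt (Set.mem_univ 0) (Set.mem_univ 1) zero_lt_one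
    (hfd.comp_hasDerivAt (0 : ℝ) hγ)
  simp only [slope_def_field, Function.comp_apply, AffineMap.lineMap_apply_one,
    AffineMap.lineMap_apply_zero, sub_zero, div_one] at h
  linarith

lemma ellf_le {E : Type*} [NormedAddCommGroup E] [NormedSpace ℝ E] {d f : E → ℝ} {lam : ℝ}
    (hf : ConvexOn ℝ Set.univ f) (hd : Differentiable ℝ f) (hsc : ScWrtR d lam f) (x y : E) :
    ellf d f lam x y ≤ f x :=
  hsc y (fderiv ℝ f y) (fun w => hf.add_fderiv_le hd w y) x

/-- The smoothness error of an accelerated step is absorbed by the strong convexity gains. -/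
lemma mul_sq_norm_sub_le_of_step {E : Type*} [NormedAddCommGroup E] [NormedSpace ℝ E]
    {σ L A a A' s t r : ℝ} (hσ : 0 < σ) (hA : 0 ≤ A) (ha : 0 < a)
    (hA' : A' = A + a) (hs : 0 < s) (ht : 0 ≤ t) (hr : 0 ≤ r)
    (hroot : (s + t + r) * A' = L / σ * a ^ 2) {x z u x' z' : E}
    (hu : u = (((s + t + r) * A' - t * a)⁻¹) •
      ((a * s) • z + ((s + t + r) * A + r * a) • x))
    (hx' : x' = A'⁻¹ • (A • x + a • z')) :
    A' * (L / 2 * ‖x' - u‖ ^ 2)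
      ≤ σ / 2 * (s * ‖z' - z‖ ^ 2 + t * ‖z' - u‖ ^ 2 + r * ‖z' - x‖ ^ 2) := by
  have hA'0 : 0 < A' := by linarith
  set T := s + t + r with hT
  have hT0 : 0 < T := by positivity
  have hM : T * A' - t * a ≠ 0 := by
    have : 0 < T * A + (s + r) * a := by positivity
    rw [hA', hT] at *
    intro h
    linarith
  have hu' : (T * A' - t * a) • u = (a * s) • z + (T * A + r * a) • x := by
    rw [hu, smul_inv_smul₀ hM]
  have hxx : A' • x' = A • x + a • z' := by rw [hx', smul_inv_smul₀ hA'0.ne']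
  have hvec : (T * A') • (x' - u) = a • (s • (z' - z) + t • (z' - u) + r • (z' - x)) := by
    calc (T * A') • (x' - u)
        = T • (A' • x') - (T * A' - t * a) • u - (t * a) • u := by module
      _ = _ := by rw [hu', hxx, hT]; module
  have hnorm : (T * A') ^ 2 * ‖x' - u‖ ^ 2
      = a ^ 2 * ‖s • (z' - z) + t • (z' - u) + r • (z' - x)‖ ^ 2 := by
    have h := congrArg (fun v => ‖v‖ ^ 2) hvec
    simpa only [norm_smul, mul_pow, Real.norm_eq_abs, sq_abs] using h
  have hle := mul_le_mul_of_nonneg_left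
    (sq_norm_add_add_le hs.le ht hr (z' - z) (z' - u) (z' - x)) (sq_nonneg a)
  rw [← hnorm, ← hT] at hle
  have hL : σ * (T * A') = L * a ^ 2 := by rw [hroot]; field_simp
  have hpos : 0 < a ^ 2 * T := by positivity
  refine le_of_mul_le_mul_left ?_ hpos
  have h2 := mul_le_mul_of_nonneg_left hle (half_pos hσ).le
  calc a ^ 2 * T * (A' * (L / 2 * ‖x' - u‖ ^ 2))
      = (L * a ^ 2) * (T * A') / 2 * ‖x' - u‖ ^ 2 := by ring
    _ = σ / 2 * ((T * A') ^ 2 * ‖x' - u‖ ^ 2) := by rw [← hL]; ring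
    _ ≤ _ := h2
    _ = _ := by ring

lemma sqrt_add_half_le_sqrt_add {A a s : ℝ} (hA : 0 ≤ A) (ha : 0 < a)
    (h : s ^ 2 * (A + a) ≤ a ^ 2) : √A + s / 2 ≤ √(A + a) := by
  have hq : 0 < √(A + a) := Real.sqrt_pos.2 (by linarith)
  have hp2 := Real.sq_sqrt hA
  have hq2 := Real.sq_sqrt (by linarith : 0 ≤ A + a)
  have hpq : √A ≤ √(A + a) := Real.sqrt_le_sqrt (by linarith)
  have h1 : s * √(A + a) ≤ a := by
    refine abs_le_of_sq_le_sq' ?_ ha.le |>.2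
    rwa [mul_pow, hq2]
  have h2 : s * √(A + a) ≤ 2 * (√(A + a) - √A) * √(A + a) := by
    have := mul_nonneg (sub_nonneg.2 hpq) (sub_nonneg.2 hpq)
    linarith
  linarith [le_of_mul_le_mul_right h2 hq]

lemma growth_of_root {σ lam1 lam2 L : ℝ} (hσ : 0 < σ) (hlam1 : 0 ≤ lam1) (hlam2 : 0 ≤ lam2)
    (hL : σ * lam1 < L) {a A : ℕ → ℝ} (hA0 : A 0 = 0) (hapos : ∀ k, 0 < a (k + 1))
    (haroot : ∀ k, (a (k + 1) + A k) * (lam1 * a (k + 1) + (lam1 + lam2) * A k + 1)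
        + a (k + 1) * lam2 * A k = L / σ * a (k + 1) ^ 2)
    (hA : ∀ k, A (k + 1) = A k + a (k + 1)) (k : ℕ) :
    √(σ / L) * ((k + 2) / 2) ≤ √(A (k + 1)) ∧
      √(σ / (L - σ * lam1)) * (1 + √(σ * (lam1 + lam2) / (4 * L))) ^ k ≤ √(A (k + 1)) := by
  have hL0 : 0 < L := (mul_nonneg hσ.le hlam1).trans_lt hL
  have hLs : 0 < L - σ * lam1 := sub_pos.2 hL
  have hAnn : ∀ k, 0 ≤ A k := by
    intro k
    induction k with
    | zero => exact hA0.ge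
    | succ k ih => rw [hA]; linarith [hapos k]
  have hroot : ∀ k, σ / L * ((a (k + 1) + A k) * (lam1 * a (k + 1) + (lam1 + lam2) * A k + 1)
        + a (k + 1) * lam2 * A k) = a (k + 1) ^ 2 := by
    intro k
    rw [haroot]
    field_simp
  induction k with
  | zero =>
    have h1 : A 1 = σ / (L - σ * lam1) := by
      have h := haroot 0
      have ha := hapos 0
      simp only [hA0, zero_add, mul_zero, add_zero] at h
      have hA1 := hA 0
      rw [hA0, zero_add, zero_add] at hA1
      rw [zero_add] at ha
      rw [hA1, eq_div_iff hLs.ne']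
      have h2 : a 1 * (σ * (lam1 * a 1 + 1)) = a 1 * (L * a 1) := by
        field_simp at h
        linear_combination a 1 * h
      have := mul_left_cancel₀ ha.ne' h2
      linarith
    rw [zero_add, h1]
    constructor
    · rw [Nat.cast_zero, zero_add, div_self two_ne_zero, mul_one]
      refine Real.sqrt_le_sqrt (div_le_div_of_nonneg_left hσ.le hLs ?_)
      linarith [mul_nonneg hσ.le hlam1]
    · rw [pow_zero, mul_one]
  | succ k ih =>
    have ha := hapos (k + 1)
    have hAk := hAnn (k + 1)
    have hr := hroot (k + 1)
    have hσL : 0 < σ / L := div_pos hσ hL0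
    rw [hA (k + 1)]
    have hsmall : 0 ≤ (a (k + 1 + 1) + A (k + 1)) * (lam1 * a (k + 1 + 1))
        + a (k + 1 + 1) * lam2 * A (k + 1) := by positivity
    have hmid : 0 ≤ (a (k + 1 + 1) + A (k + 1)) * ((lam1 + lam2) * A (k + 1)) := by positivity
    constructor
    · have h := sqrt_add_half_le_sqrt_add (s := √(σ / L)) hAk ha (by
        rw [Real.sq_sqrt hσL.le, ← hr]
        refine mul_le_mul_of_nonneg_left ?_ hσL.le
        linarith)
      push_cast
      linarith [ih.1]
    · have hs : √(σ * (lam1 + lam2) / (4 * L)) = √(σ * (lam1 + lam2) / L) / 2 := by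
        rw [show σ * (lam1 + lam2) / (4 * L) = σ * (lam1 + lam2) / L / 2 ^ 2 by
          field_simp; norm_num, Real.sqrt_div' _ (by norm_num), Real.sqrt_sq (by norm_num)]
      have h := sqrt_add_half_le_sqrt_add
        (s := √(σ * (lam1 + lam2) / L) * √(A (k + 1))) hAk ha (by
        rw [mul_pow, Real.sq_sqrt hAk, Real.sq_sqrt (by positivity), ← hr,
          show σ * (lam1 + lam2) / L = σ / L * (lam1 + lam2) by ring, mul_assoc, mul_assoc]
        refine mul_le_mul_of_nonneg_left ?_ hσL.le
        linarith)
      have h2 := mul_le_mul_of_nonneg_right ih.2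
        (by positivity : 0 ≤ 1 + √(σ * (lam1 + lam2) / (4 * L)))
      rw [pow_succ, ← mul_assoc]
      refine h2.trans (le_trans (le_of_eq ?_) h)
      rw [hs]; ring

lemma inv_le_rate_of_root {σ lam1 lam2 L : ℝ} (hσ : 0 < σ) (hlam1 : 0 ≤ lam1)
    (hlam2 : 0 ≤ lam2)
    (hL : σ * lam1 < L) {a A : ℕ → ℝ} (hA0 : A 0 = 0) (hapos : ∀ k, 0 < a (k + 1))
    (haroot : ∀ k, (a (k + 1) + A k) * (lam1 * a (k + 1) + (lam1 + lam2) * A k + 1)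
        + a (k + 1) * lam2 * A k = L / σ * a (k + 1) ^ 2)
    (hA : ∀ k, A (k + 1) = A k + a (k + 1)) {k : ℕ} (hk : 1 ≤ k) :
    (A k)⁻¹ ≤ min (4 * L / (σ * ((k : ℝ) + 1) ^ 2))
      ((L - σ * lam1) / σ *
        ((1 + √(σ * (lam1 + lam2) / (4 * L))) ^ (2 * k - 2))⁻¹) := by
  obtain ⟨k, rfl⟩ := Nat.exists_eq_add_of_le' hk
  have hL0 : 0 < L := (mul_nonneg hσ.le hlam1).trans_lt hL
  have hLs : 0 < L - σ * lam1 := sub_pos.2 hL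
  obtain ⟨h1, h2⟩ := growth_of_root hσ hlam1 hlam2 hL hA0 hapos haroot hA k
  have hsq : ∀ {b : ℝ}, 0 < b → b ≤ √(A (k + 1)) → (A (k + 1))⁻¹ ≤ (b ^ 2)⁻¹ := by
    intro b hb hle
    exact inv_anti₀ (by positivity) ((Real.le_sqrt' hb).1 hle)
  refine le_min ((hsq (by positivity) h1).trans_eq ?_) ((hsq (by positivity) h2).trans_eq ?_)
  · rw [mul_pow, Real.sq_sqrt (by positivity)]
    push_cast
    field_simp
    ring
  · rw [mul_pow, Real.sq_sqrt (by positivity), show 2 * (k + 1) - 2 = k * 2 by omega, pow_mul,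
      mul_inv, inv_div]

/-- rate of convergence for AGM-EF-∞. -/
theorem stmt8 {E : Type*} [NormedAddCommGroup E] [NormedSpace ℝ E] [FiniteDimensional ℝ E]
    (σ lam1 lam2 L : ℝ) (hσ : 0 < σ) (hlam1 : 0 ≤ lam1) (hlam2 : 0 ≤ lam2)
    (hL : σ * lam1 < L)
    (d : E → ℝ) (hddiff : Differentiable ℝ d) (hdconv : ConvexOn ℝ Set.univ d)
    (hdsc : StrongConvexOnNorm σ d)
    (Ψ : E → EReal) (hΨbot : ∀ x, Ψ x ≠ ⊥) (hΨprop : ∃ x, Ψ x ≠ ⊤)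
    (hΨlsc : LowerSemicontinuous Ψ) (hΨconv : ConvexE Ψ) (hΨsc : ScWrtE d lam2 Ψ)
    (f : E → ℝ) (hfconv : ConvexOn ℝ Set.univ f) (hfdiff : Differentiable ℝ f)
    (hfsc : ScWrtR d lam1 f)
    (hfL : ∀ x y : E, ‖fderiv ℝ f x - fderiv ℝ f y‖ ≤ L * ‖x - y‖)
    -- Algorithm AGM-EF-∞
    (x z u : ℕ → E) (a A : ℕ → ℝ) (ψ : ℕ → E → EReal)
    (hx0 : Ψ (x 0) ≠ ⊤) (hz0 : z 0 = x 0) (hA0 : A 0 = 0)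
    (hψ0 : ∀ w, ψ 0 w = ((breg d w (x 0) : ℝ) : EReal))
    (hapos : ∀ k, 0 < a (k + 1))
    (haroot : ∀ k, (a (k + 1) + A k) * (lam1 * a (k + 1) + (lam1 + lam2) * A k + 1)
        + a (k + 1) * lam2 * A k = L / σ * a (k + 1) ^ 2)
    (hA : ∀ k, A (k + 1) = A k + a (k + 1))
    (hu : ∀ k,
      u (k + 1) =
        ((((1 + (lam1 + lam2) * A k) + lam1 * a (k + 1)
              + lam2 * a (k + 1) * A k / A (k + 1)) * A (k + 1)
            - lam1 * a (k + 1) * a (k + 1))⁻¹) •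
          ((a (k + 1) * (1 + (lam1 + lam2) * A k)) • z k
            + ((((1 + (lam1 + lam2) * A k) + lam1 * a (k + 1)
                  + lam2 * a (k + 1) * A k / A (k + 1)) * A k
                + (lam2 * a (k + 1) * A k / A (k + 1)) * a (k + 1)) • x k)))
    (hψ : ∀ k w, ψ (k + 1) w =
      ψ k w + ((a (k + 1) : ℝ) : EReal) * (Ψ w + ((ellf d f lam1 w (u (k + 1)) : ℝ) : EReal)))
    (hz : ∀ k w, ψ (k + 1) (z (k + 1)) ≤ ψ (k + 1) w)
    (hx : ∀ k, x (k + 1) = (A (k + 1))⁻¹ • (A k • x k + a (k + 1) • z (k + 1)))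
    :
    ∀ k : ℕ, 1 ≤ k → ∀ w : E, Ψ w ≠ ⊤ →
      (((f (x k) : ℝ) : EReal) + Ψ (x k)) - (((f w : ℝ) : EReal) + Ψ w) ≤
        ((breg d w (x 0) *
            min (4 * L / (σ * ((k : ℝ) + 1) ^ 2))
              ((L - σ * lam1) / σ *
                ((1 + Real.sqrt (σ * (lam1 + lam2) / (4 * L))) ^ (2 * k - 2))⁻¹) : ℝ) :
          EReal) := by
  have hApos : ∀ k, 0 ≤ A k ∧ 0 < A (k + 1) := by
    intro k
    induction k with
    | zero => exact ⟨hA0.ge, by linarith [hA 0, hapos 0]⟩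
    | succ k ih => exact ⟨ih.2.le, by linarith [hA (k + 1), hapos (k + 1), ih.2]⟩
  have hbreg : ∀ v y, σ / 2 * ‖v - y‖ ^ 2 ≤ breg d v y := hdsc.le_breg
  have hbreg0 : ∀ v y, 0 ≤ breg d v y := fun v y => le_trans (by positivity) (hbreg v y)
  obtain ⟨q, hq0, hq⟩ : ∃ q : ℕ → E → ℝ, (∀ w, q 0 w = breg d w (x 0)) ∧
      ∀ k w, q (k + 1) w = q k w + a (k + 1) * ellf d f lam1 w (u (k + 1)) :=
    ⟨fun k => Nat.rec (fun w => breg d w (x 0))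
      (fun k r w => r w + a (k + 1) * ellf d f lam1 w (u (k + 1))) k,
      fun _ => rfl, fun _ _ => rfl⟩
  have hψreal : ∀ k w, Ψ w ≠ ⊤ → ψ k w = ((A k * (Ψ w).toReal + q k w : ℝ) : EReal) := by
    intro k w hw
    induction k with
    | zero => rw [hψ0, hA0, hq0, zero_mul, zero_add]
    | succ k ih =>
      rw [hψ, ih]
      nth_rewrite 2 [← EReal.coe_toReal hw (hΨbot w)]
      rw [← EReal.coe_add, ← EReal.coe_mul, ← EReal.coe_add, hq, hA]
      congr 1
      ring
  have hψtop : ∀ k w, Ψ w = ⊤ → ψ k w ≠ ⊥ ∧ ψ (k + 1) w = ⊤ := by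
    intro k w hw
    have hstep : ∀ k, ψ k w ≠ ⊥ → ψ (k + 1) w = ⊤ := by
      intro k h
      rw [hψ, hw, EReal.top_add_coe, EReal.coe_mul_top_of_pos (hapos k),
        EReal.add_top_of_ne_bot h]
    have hbot : ∀ k, ψ k w ≠ ⊥ := by
      intro k
      induction k with
      | zero => rw [hψ0]; exact EReal.coe_ne_bot _
      | succ k ih => rw [hstep k ih]; exact top_ne_bot
    exact ⟨hbot k, hstep k (hbot k)⟩
  have hzD : ∀ k, Ψ (z k) ≠ ⊤ := by
    intro k
    cases k with
    | zero => rwa [hz0]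
    | succ k =>
      intro h
      have h1 := hz k (x 0)
      rw [(hψtop k _ h).2, hψreal _ _ hx0] at h1
      exact EReal.coe_ne_top _ (top_le_iff.1 h1)
  have hxcomb : ∀ k, x (k + 1)
      = (A k / A (k + 1)) • x k + (a (k + 1) / A (k + 1)) • z (k + 1) := by
    intro k
    rw [hx, smul_add, smul_smul, smul_smul, inv_mul_eq_div, inv_mul_eq_div]
  have hw0 : ∀ k, 0 ≤ A k / A (k + 1) := fun k => div_nonneg (hApos k).1 (hApos k).2.le
  have hw1 : ∀ k, 0 ≤ a (k + 1) / A (k + 1) := fun k => div_nonneg (hapos k).le (hApos k).2.le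
  have hwsum : ∀ k, A k / A (k + 1) + a (k + 1) / A (k + 1) = 1 := by
    intro k
    rw [← add_div, ← hA, div_self (hApos k).2.ne']
  have hxD : ∀ k, Ψ (x k) ≠ ⊤ := by
    intro k
    induction k with
    | zero => exact hx0
    | succ k ih =>
      rw [hxcomb]
      exact (hΨconv.convexOn_toReal hΨbot).1 ih (hzD _) (hw0 k) (hw1 k) (hwsum k)
  -- `q k` is a multiple of `d` plus an affine function.
  have hqaff : ∀ k, ∃ (g : E →L[ℝ] ℝ) (b : ℝ), ∀ w,
      q k w = (1 + lam1 * A k) * d w + g w + b := by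
    intro k
    induction k with
    | zero =>
      refine ⟨-fderiv ℝ d (x 0), fderiv ℝ d (x 0) (x 0) - d (x 0), fun w => ?_⟩
      rw [hq0, hA0, breg, map_sub, neg_apply]
      ring
    | succ k ih =>
      obtain ⟨g, b, h⟩ := ih
      refine ⟨g + a (k + 1) • (fderiv ℝ f (u (k + 1)) - lam1 • fderiv ℝ d (u (k + 1))),
        b + a (k + 1) * (f (u (k + 1)) - fderiv ℝ f (u (k + 1)) (u (k + 1))
          + lam1 * (fderiv ℝ d (u (k + 1)) (u (k + 1)) - d (u (k + 1)))), fun w => ?_⟩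
      rw [hq, h, hA, ellf, breg, map_sub, map_sub]
      simp only [add_apply, sub_apply, smul_apply, smul_eq_mul]
      ring
  -- Strong convexity of the estimate sequence at its minimizers.
  have hest : ∀ k w, Ψ w ≠ ⊤ →
      A k * (Ψ (z k)).toReal + q k (z k) + (1 + (lam1 + lam2) * A k) * breg d w (z k)
        ≤ A k * (Ψ w).toReal + q k w := by
    intro k w hw
    cases k with
    | zero =>
      rw [hA0, hq0, hq0, hz0]
      have : breg d (x 0) (x 0) = 0 := by simp [breg]
      rw [this]
      linarith
    | succ k =>
      obtain ⟨g, b, h⟩ := hqaff (k + 1)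
      have hder : HasFDerivAt (q (k + 1))
          ((1 + lam1 * A (k + 1)) • fderiv ℝ d (z (k + 1)) + g) (z (k + 1)) := by
        rw [funext h]
        exact (((hddiff _).hasFDerivAt.const_mul _).add g.hasFDerivAt).add_const b
      have hmin : ∀ᶠ w in nhds (z (k + 1)), Ψ w ≠ ⊤ →
          A (k + 1) * (Ψ (z (k + 1))).toReal + q (k + 1) (z (k + 1))
            ≤ A (k + 1) * (Ψ w).toReal + q (k + 1) w := by
        refine Filter.Eventually.of_forall fun w hw => ?_
        have h1 := hz k w
        rw [hψreal _ _ hw, hψreal _ _ (hzD _)] at h1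
        exact_mod_cast h1
      have h1 := hΨsc.le_of_eventually_min hΨbot hΨconv (hzD (k + 1)) (hApos k).2 hder hmin hw
      simp only [add_apply, smul_apply, smul_eq_mul] at h1
      rw [h w, h (z (k + 1))]
      have h2 : g (w - z (k + 1)) = g w - g (z (k + 1)) := map_sub _ _ _
      unfold breg at h1 ⊢
      linarith
  have hupper : ∀ k w, q k w ≤ A k * f w + breg d w (x 0) := by
    intro k w
    induction k with
    | zero => rw [hq0, hA0]; linarith
    | succ k ih =>
      rw [hq, hA]
      have := mul_le_mul_of_nonneg_left (ellf_le hfconv hfdiff hfsc w (u (k + 1))) (hapos k).le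
      linarith
  have hlower : ∀ k, A k * (f (x k) + (Ψ (x k)).toReal)
      ≤ A k * (Ψ (z k)).toReal + q k (z k) := by
    intro k
    induction k with
    | zero => rw [hA0, hq0, zero_mul, zero_mul, zero_add]; exact hbreg0 _ _
    | succ k ih =>
      have hA' := (hApos k).2
      have hAk := (hApos k).1
      have ha := hapos k
      have hΨc := hΨsc.toReal_convex_comb_le hσ hlam2 hddiff hdsc hΨbot hΨlsc hΨconv
        (hxD k) (hzD (k + 1)) (hw0 k) (hw1 k) (hwsum k)
      rw [← hxcomb] at hΨc
      have hΨc' : A (k + 1) * (Ψ (x (k + 1))).toReal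
          + lam2 * a (k + 1) * A k / A (k + 1) * (σ / 2 * ‖z (k + 1) - x k‖ ^ 2)
          ≤ A k * (Ψ (x k)).toReal + a (k + 1) * (Ψ (z (k + 1))).toReal := by
        have h := mul_le_mul_of_nonneg_left hΨc hA'.le
        rw [norm_sub_rev (x k)] at h
        refine (le_of_eq ?_).trans (h.trans (le_of_eq ?_)) <;> field_simp
      have hgap := mul_sq_norm_sub_le_of_step (L := L) (s := 1 + (lam1 + lam2) * A k)
        (t := lam1 * a (k + 1)) (r := lam2 * a (k + 1) * A k / A (k + 1)) hσ hAk ha (hA k)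
        (by positivity) (by positivity) (by positivity)
        (by
          rw [← haroot k, add_mul _ (lam2 * a (k + 1) * A k / A (k + 1)),
            div_mul_cancel₀ _ hA'.ne', hA k]
          ring) (hu k) (hx k)
      have hdesc := mul_le_mul_of_nonneg_left
        (le_quadratic_of_lipschitz_fderiv hfdiff hfL (x (k + 1)) (u (k + 1))) hA'.le
      have hlin : A (k + 1) * fderiv ℝ f (u (k + 1)) (x (k + 1) - u (k + 1))
          = A k * fderiv ℝ f (u (k + 1)) (x k - u (k + 1))
            + a (k + 1) * fderiv ℝ f (u (k + 1)) (z (k + 1) - u (k + 1)) := by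
        rw [← smul_eq_mul, ← smul_eq_mul, ← smul_eq_mul, ← map_smul, ← map_smul, ← map_smul,
          ← map_add]
        congr 1
        rw [smul_sub, hx k, smul_inv_smul₀ hA'.ne', hA k]
        module
      have hfx := mul_le_mul_of_nonneg_left
        (ellf_le hfconv hfdiff hfsc (x k) (u (k + 1))) hAk
      have hb1 := mul_nonneg hAk (mul_nonneg hlam1 (hbreg0 (x k) (u (k + 1))))
      have hb2 := mul_le_mul_of_nonneg_left (hbreg (z (k + 1)) (u (k + 1)))
        (mul_nonneg hlam1 ha.le)
      have hb3 := mul_le_mul_of_nonneg_left (hbreg (z (k + 1)) (z k))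
        (by positivity : 0 ≤ 1 + (lam1 + lam2) * A k)
      have he := hest k (z (k + 1)) (hzD _)
      rw [hq]
      unfold ellf at hfx ⊢
      have hAf : A (k + 1) * f (u (k + 1)) = A k * f (u (k + 1)) + a (k + 1) * f (u (k + 1)) := by
        rw [hA]; ring
      have hAΨ : A (k + 1) * (Ψ (z (k + 1))).toReal
          = A k * (Ψ (z (k + 1))).toReal + a (k + 1) * (Ψ (z (k + 1))).toReal := by
        rw [hA]; ring
      linarith
  intro k hk w hw
  have hAk : 0 < A k := by
    obtain ⟨k, rfl⟩ := Nat.exists_eq_add_of_le' hk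
    exact (hApos k).2
  have hreal : f (x k) + (Ψ (x k)).toReal - (f w + (Ψ w).toReal)
      ≤ breg d w (x 0) * (A k)⁻¹ := by
    rw [← div_eq_mul_inv, le_div_iff₀ hAk]
    have h1 := hest k w hw
    have h2 := hlower k
    have h3 := hupper k w
    have h4 := mul_nonneg (by have := hAk.le; positivity : 0 ≤ 1 + (lam1 + lam2) * A k)
      (hbreg0 w (z k))
    linarith
  have hrate := mul_le_mul_of_nonneg_left
    (inv_le_rate_of_root hσ hlam1 hlam2 hL hA0 hapos haroot hA hk) (hbreg0 w (x 0))
  rw [← EReal.coe_toReal hw (hΨbot w), ← EReal.coe_toReal (hxD k) (hΨbot (x k))]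
  exact_mod_cast hreal.trans hrate
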